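/- arXiv:2211.11805 — 2 statements merged into one kernel-verified Lean document; each statement's English description precedes it below -/
import Mathlib

section
/- Let Ω be a smooth bounded domain in ℝⁿ (n ≥ 3), star-shaped with respect to the origin, and let h ∈ C¹(Ω) satisfy h(x) + (1/2)⟨x, ∇h(x)⟩ ≥ 0 for all x ∈ Ω, with strict inequality somewhere. Then any C² solution u of −Δu + h u = |u|^{4/(n−2)} u in Ω with u = 0 on ∂Ω that moreover satisfies ∫_Ω (h + ⟨x,∇h⟩/2) u² dx > 0 whenever u ≢ 0, must be identically zero. (Pohožaev obstruction.) -/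
open MeasureTheory Metric Real Filter
open scoped InnerProductSpace Topology ENNReal

noncomputable def lap {n : ℕ} (u : EuclideanSpace ℝ (Fin n) → ℝ)
    (x : EuclideanSpace ℝ (Fin n)) : ℝ :=
  ∑ i, fderiv ℝ (fun y => fderiv ℝ u y (EuclideanSpace.single i 1)) x (EuclideanSpace.single i 1)

section LipschitzTools

variable {E : Type*} [NormedAddCommGroup E] [NormedSpace ℝ E]

theorem IsOpen.fderiv_indicator {Ω : Set E} (hΩ : IsOpen Ω) (g : E → ℝ) {x : E} (hx : x ∈ Ω) :
    fderiv ℝ (Ω.indicator g) x = fderiv ℝ g x :=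
  Filter.EventuallyEq.fderiv_eq <| by
    filter_upwards [hΩ.mem_nhds hx] with y hy using Set.indicator_of_mem hy g

theorem Set.indicator_smul_eq_zero_of_starShaped {Ω : Set E}
    (hstar : ∀ x ∈ Ω, ∀ t ∈ Set.Icc (0 : ℝ) 1, t • x ∈ Ω) (g : E → ℝ)
    {l : ℝ} (hl : 1 ≤ l) {x : E} (hx : x ∉ Ω) : Ω.indicator g (l • x) = 0 := by
  refine Set.indicator_of_notMem (fun hlx => hx ?_) g
  have := hstar _ hlx l⁻¹ ⟨by positivity, inv_le_one_of_one_le₀ hl⟩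
  rwa [inv_smul_smul₀ (by positivity)] at this

theorem hasDerivAt_inv_pow_one (k : ℕ) : HasDerivAt (fun l : ℝ => (l ^ k)⁻¹) (-(k : ℝ)) 1 := by
  simpa using (hasDerivAt_pow k (1 : ℝ)).fun_inv (by simp)

theorem HasDerivWithinAt.nonneg_of_forall_nonneg {Φ : ℝ → ℝ} {a d : ℝ}
    (hd : HasDerivWithinAt Φ d (Set.Ici a) a) (h0 : Φ a = 0) (hpos : ∀ l, a ≤ l → 0 ≤ Φ l) :
    0 ≤ d := by
  rw [hasDerivWithinAt_iff_tendsto_slope, Set.Ici_sdiff_left] at hd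
  refine ge_of_tendsto hd ?_
  filter_upwards [self_mem_nhdsWithin] with l hl
  have hl' : a < l := hl
  rw [slope_def_field, h0, sub_zero]
  exact div_nonneg (hpos l hl'.le) (by linarith)

variable [FiniteDimensional ℝ E]

theorem Bornology.IsBounded.exists_lipschitzWith_indicator {Ω : Set E}
    (hΩb : Bornology.IsBounded Ω) {g : E → ℝ} (hg : ContDiff ℝ 1 g)
    (hg0 : ∀ x ∈ frontier Ω, g x = 0) :
    ∃ K, LipschitzWith K (Ω.indicator g) := by
  obtain ⟨R, hR⟩ := hΩb.closure.subset_closedBall (0 : E)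
  obtain ⟨C, hC⟩ := (isCompact_closedBall (0 : E) R).exists_bound_of_continuousOn
    (hg.continuous_fderiv one_ne_zero).continuousOn
  have hball : ∀ x ∈ closedBall (0 : E) R, ∀ y ∈ closedBall (0 : E) R,
      ‖g y - g x‖ ≤ max C 0 * ‖y - x‖ := fun x hx y hy =>
    (convex_closedBall (0 : E) R).norm_image_sub_le_of_norm_fderiv_le
      (fun z _ => (hg.differentiable one_ne_zero) z)
      (fun z hz => (hC z hz).trans (le_max_left _ _)) hx hy
  have hout : ∀ x ∈ Ω, ∀ y ∉ Ω, |g x| ≤ max C 0 * dist x y := by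
    intro x hx y hy
    obtain ⟨z, hz, hdist⟩ := exists_mem_frontier_infDist_compl_eq_dist hx
      (fun hs => hy (hs ▸ Set.mem_univ y))
    have h1 := hball z (hR (frontier_subset_closure hz)) x (hR (subset_closure hx))
    rw [hg0 z hz, sub_zero, Real.norm_eq_abs, ← dist_eq_norm, ← hdist] at h1
    exact h1.trans (mul_le_mul_of_nonneg_left (infDist_le_dist_of_mem hy) (le_max_right _ _))
  refine ⟨(max C 0).toNNReal, LipschitzWith.of_dist_le_mul fun x y => ?_⟩
  rw [Real.coe_toNNReal _ (le_max_right _ _), Real.dist_eq]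
  by_cases hx : x ∈ Ω <;> by_cases hy : y ∈ Ω
  · simpa [hx, hy, dist_eq_norm] using hball y (hR (subset_closure hy)) x (hR (subset_closure hx))
  · simpa [hx, hy] using hout x hx y hy
  · simpa [hx, hy, dist_comm] using hout y hy x hx
  · simp only [Set.indicator_of_notMem hx, Set.indicator_of_notMem hy, sub_zero, abs_zero]
    positivity

variable [MeasurableSpace E] [BorelSpace E] {μ : Measure E} [μ.IsAddHaarMeasure]

/-- The derivative of a Lipschitz function vanishes almost everywhere on its zero set. -/
theorem LipschitzWith.ae_fderiv_eq_zero_of_eq_zero {K : NNReal} {v : E → ℝ}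
    (hv : LipschitzWith K v) :
    ∀ᵐ x ∂μ, v x = 0 → fderiv ℝ v x = 0 := by
  set s : Set E := {x | v x = 0} ∩ {x | DifferentiableAt ℝ v x} with hs
  have hsm : MeasurableSet s := (hv.continuous.measurable (measurableSet_singleton 0)).inter
    (measurableSet_of_differentiableAt ℝ v)
  have key : ∀ e : E, e ≠ 0 → ∀ᵐ x ∂μ, x ∈ s → fderiv ℝ v x = 0 := by
    intro e he
    have happ : ApproximatesLinearOn (fun x => v x • e) (0 : E →L[ℝ] E) s 0 := by
      intro x hx y hy
      have h1 : v x = 0 := hx.1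
      have h2 : v y = 0 := hy.1
      simp [h1, h2]
    have := happ.norm_fderiv_sub_le μ hsm (fun x => (fderiv ℝ v x).smulRight e)
      (fun x hx => (hx.2.hasFDerivAt.smul_const e).hasFDerivWithinAt)
    rw [ae_restrict_iff' hsm] at this
    filter_upwards [this] with x hx hxs
    have h0 := hx hxs
    simp only [sub_zero, nonpos_iff_eq_zero, nnnorm_eq_zero] at h0
    ext y
    have := congrArg (fun L : E →L[ℝ] E => L y) h0
    simpa [he] using this
  rcases subsingleton_or_nontrivial E with hE | hE
  · refine Eventually.of_forall fun x _ => ?_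
    ext y
    simp [Subsingleton.elim y 0]
  · obtain ⟨e, he⟩ := exists_ne (0 : E)
    filter_upwards [key e he, hv.ae_differentiableAt (μ := μ)] with x hx hd hx0
    exact hx ⟨hx0, hd⟩

theorem LipschitzWith.ae_fderiv_eq_zero_of_notMem {K : NNReal} {v : E → ℝ} {Ω : Set E}
    (hv : LipschitzWith K v) (hv0 : ∀ x ∉ Ω, v x = 0) :
    ∀ᵐ x ∂μ, x ∉ Ω → fderiv ℝ v x = 0 := by
  filter_upwards [hv.ae_fderiv_eq_zero_of_eq_zero (μ := μ)] with x hx hxΩ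
  exact hx (hv0 x hxΩ)

theorem Bornology.IsBounded.integrableOn_of_continuous {Ω : Set E} (hΩb : Bornology.IsBounded Ω)
    {f : E → ℝ} (hf : Continuous f) : IntegrableOn f Ω μ := by
  obtain ⟨R, hR⟩ := hΩb.subset_closedBall (0 : E)
  exact (hf.continuousOn.integrableOn_compact (isCompact_closedBall (0 : E) R)).mono_set hR

theorem LipschitzWith.integrable_fderiv_mul_fderiv {K L : NNReal} {v w : E → ℝ} {Ω : Set E}
    (hΩb : Bornology.IsBounded Ω)
    (hv : LipschitzWith K v) (hv0 : ∀ x ∉ Ω, v x = 0) (hw : LipschitzWith L w) (e : E) :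
    Integrable (fun x => fderiv ℝ v x e * fderiv ℝ w x e) μ := by
  have hon : IntegrableOn (fun x => fderiv ℝ v x e * fderiv ℝ w x e) Ω μ := by
    refine Measure.integrableOn_of_bounded (M := (K * ‖e‖) * (L * ‖e‖))
      hΩb.measure_lt_top.ne ?_ (Eventually.of_forall fun x => ?_)
    · exact ((measurable_fderiv_apply_const ℝ v e).mul
        (measurable_fderiv_apply_const ℝ w e)).aestronglyMeasurable
    · rw [norm_mul]
      gcongr
      · exact (fderiv ℝ v x).le_of_opNorm_le (norm_fderiv_le_of_lipschitz ℝ hv) e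
      · exact (fderiv ℝ w x).le_of_opNorm_le (norm_fderiv_le_of_lipschitz ℝ hw) e
  refine hon.integrable_of_ae_notMem_eq_zero ?_
  filter_upwards [hv.ae_fderiv_eq_zero_of_notMem (μ := μ) hv0] with x hx hxΩ
  simp [hx hxΩ]

/-- Integration by parts on a bounded open set, against a Lipschitz function vanishing outside. -/
theorem LipschitzWith.setIntegral_fderiv_mul {K : NNReal} {v w : E → ℝ} {Ω : Set E}
    (hΩo : IsOpen Ω) (hΩb : Bornology.IsBounded Ω)
    (hv : LipschitzWith K v) (hv0 : ∀ x ∉ Ω, v x = 0) (hw : ContDiff ℝ 1 w) (e : E) :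
    ∫ x in Ω, fderiv ℝ v x e * w x ∂μ = -∫ x in Ω, v x * fderiv ℝ w x e ∂μ := by
  obtain ⟨R, hRpos, hR⟩ := hΩb.subset_ball_lt 0 (0 : E)
  let χ : ContDiffBump (0 : E) := ⟨R, R + 1, hRpos, by linarith⟩
  have hχs : HasCompactSupport (fun x => χ x * w x) := χ.hasCompactSupport.mul_right
  have hχc : ContDiff ℝ 1 (fun x => χ x * w x) := χ.contDiff.mul hw
  obtain ⟨L, hL⟩ := hχc.lipschitzWith_of_hasCompactSupport hχs one_ne_zero
  have hloc : ∀ x ∈ Ω, (fun y => χ y * w y) =ᶠ[𝓝 x] w := by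
    intro x hx
    filter_upwards [hΩo.mem_nhds hx] with y hy
    rw [χ.one_of_mem_closedBall (ball_subset_closedBall (hR hy)), one_mul]
  have hibp := hv.integral_lineDeriv_mul_eq (μ := μ) hL hχs e
  have h1 : ∫ x in Ω, fderiv ℝ v x e * w x ∂μ
      = ∫ x, lineDeriv ℝ v x e * (χ x * w x) ∂μ := by
    rw [← setIntegral_eq_integral_of_ae_compl_eq_zero (μ := μ) (s := Ω)]
    · refine setIntegral_congr_ae hΩo.measurableSet ?_
      filter_upwards [hv.ae_differentiableAt (μ := μ)] with x hx hxΩ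
      rw [hx.lineDeriv_eq_fderiv, (hloc x hxΩ).eq_of_nhds]
    · filter_upwards [hv.ae_differentiableAt (μ := μ),
        hv.ae_fderiv_eq_zero_of_notMem (μ := μ) hv0] with x hx hx0 hxΩ
      rw [hx.lineDeriv_eq_fderiv, hx0 hxΩ]
      simp
  have h2 : ∫ x, lineDeriv ℝ (fun x => χ x * w x) x (-e) * v x ∂μ
      = ∫ x in Ω, -(v x * fderiv ℝ w x e) ∂μ := by
    rw [← setIntegral_eq_integral_of_forall_compl_eq_zero (s := Ω)]
    · refine setIntegral_congr_fun hΩo.measurableSet fun x hx => ?_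
      rw [((hχc.differentiable one_ne_zero) x).lineDeriv_eq_fderiv, (hloc x hx).fderiv_eq, map_neg]
      ring
    · intro x hx
      rw [hv0 x hx, mul_zero]
  rw [h1, hibp, h2, integral_neg]

/-- Differentiation of `l ↦ ∫ f(x) v(l x) dx` at `l = 1`, where `v` is a Lipschitz truncation. -/
theorem LipschitzWith.hasDerivAt_setIntegral_comp_smul {K : NNReal} {f g : E → ℝ} {Ω : Set E}
    (hΩo : IsOpen Ω) (hΩb : Bornology.IsBounded Ω)
    (hv : LipschitzWith K (Ω.indicator g)) (hf : Continuous f) (hg : ContDiff ℝ 1 g) :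
    HasDerivAt (fun l : ℝ => ∫ x in Ω, f x * Ω.indicator g (l • x) ∂μ)
      (∫ x in Ω, f x * fderiv ℝ g x x ∂μ) 1 := by
  refine (hasDerivAt_integral_of_dominated_loc_of_lip (μ := μ.restrict Ω) (s := Set.univ)
    (F := fun (l : ℝ) x => f x * Ω.indicator g (l • x)) (x₀ := (1 : ℝ))
    (bound := fun x => |f x| * (K * ‖x‖)) univ_mem ?_ ?_ ?_ ?_ ?_ ?_).2
  · refine Eventually.of_forall fun l => ?_
    exact (hf.mul (hv.continuous.comp (continuous_const_smul l))).aestronglyMeasurable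
  · exact hΩb.integrableOn_of_continuous
      (hf.mul (hv.continuous.comp (continuous_const_smul (1 : ℝ))))
  · exact (hf.mul ((hg.continuous_fderiv one_ne_zero).clm_apply
      continuous_id)).aestronglyMeasurable
  · refine Eventually.of_forall fun x => LipschitzWith.lipschitzOnWith ?_
    refine LipschitzWith.of_dist_le_mul fun l m => ?_
    rw [Real.coe_nnabs, abs_of_nonneg (by positivity), Real.dist_eq, ← mul_sub, abs_mul, mul_assoc]
    gcongr
    have := hv.dist_le_mul (l • x) (m • x)
    rw [dist_eq_norm (l • x), ← sub_smul, norm_smul, Real.dist_eq] at this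
    rw [Real.dist_eq]
    calc _ ≤ _ := this
      _ = _ := by rw [Real.norm_eq_abs]; ring
  · exact hΩb.integrableOn_of_continuous (by fun_prop)
  · refine (ae_restrict_iff' hΩo.measurableSet).2 (Eventually.of_forall fun x hx => ?_)
    refine HasDerivAt.const_mul (f x) ?_
    have hsm : HasDerivAt (fun l : ℝ => l • x) x 1 := by
      simpa using (hasDerivAt_id (1 : ℝ)).smul_const x
    have hgd : HasFDerivAt (Ω.indicator g) (fderiv ℝ g x) ((1 : ℝ) • x) := by
      rw [one_smul]
      refine ((hg.differentiable one_ne_zero) x).hasFDerivAt.congr_of_eventuallyEq ?_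
      filter_upwards [hΩo.mem_nhds hx] with y hy using Set.indicator_of_mem hy g
    exact hgd.comp_hasDerivAt 1 hsm

/-- The divergence theorem for the field `g(x) x` on a star-shaped open set. -/
theorem setIntegral_fderiv_self_of_starShaped {g : E → ℝ} {Ω : Set E}
    (hΩo : IsOpen Ω) (hΩb : Bornology.IsBounded Ω)
    (hstar : ∀ x ∈ Ω, ∀ t ∈ Set.Icc (0 : ℝ) 1, t • x ∈ Ω)
    (hg : ContDiff ℝ 1 g) (hg0 : ∀ x ∈ frontier Ω, g x = 0) :
    ∫ x in Ω, fderiv ℝ g x x ∂μ = -(Module.finrank ℝ E : ℝ) * ∫ x in Ω, g x ∂μ := by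
  obtain ⟨K, hK⟩ := hΩb.exists_lipschitzWith_indicator hg hg0
  have h1 := (hK.hasDerivAt_setIntegral_comp_smul (μ := μ) (f := fun _ => 1) hΩo hΩb
    continuous_const hg).hasDerivWithinAt (s := Set.Ici 1)
  have h2 := ((hasDerivAt_inv_pow_one (Module.finrank ℝ E)).mul_const
    (∫ x in Ω, g x ∂μ)).hasDerivWithinAt (s := Set.Ici 1)
  have heq : ∀ l ∈ Set.Ici (1 : ℝ), ∫ x in Ω, 1 * Ω.indicator g (l • x) ∂μ
      = (l ^ Module.finrank ℝ E)⁻¹ * ∫ x in Ω, g x ∂μ := by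
    intro l hl
    have hl' : (1 : ℝ) ≤ l := hl
    simp only [one_mul]
    rw [setIntegral_eq_integral_of_forall_compl_eq_zero
      fun x hx => Set.indicator_smul_eq_zero_of_starShaped hstar g hl' hx,
      Measure.integral_comp_smul_of_nonneg μ _ _ (hR := by positivity), smul_eq_mul,
      integral_indicator hΩo.measurableSet]
  have h3 := h2.congr heq (heq 1 Set.self_mem_Ici)
  simpa using (uniqueDiffWithinAt_Ici (1 : ℝ)).eq_deriv _ h1 h3

end LipschitzTools

section Pohozaev

variable {n : ℕ} {Ω : Set (EuclideanSpace ℝ (Fin n))} {u : EuclideanSpace ℝ (Fin n) → ℝ}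

theorem ContDiff.fderiv_apply_single (hu : ContDiff ℝ 2 u) (i : Fin n) :
    ContDiff ℝ 1 (fun y => fderiv ℝ u y (EuclideanSpace.single i 1)) :=
  (hu.fderiv_right (m := 1) (by norm_num)).clm_apply contDiff_const

theorem ContDiff.continuous_lap (hu : ContDiff ℝ 2 u) : Continuous (lap u) :=
  continuous_finsetSum _ fun i _ =>
    ((hu.fderiv_apply_single i).continuous_fderiv one_ne_zero).clm_apply continuous_const

/-- Green's formula on a bounded open set, for a Lipschitz function vanishing outside. -/
theorem LipschitzWith.sum_integral_fderiv_mul_eq_lap {K : NNReal}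
    {v : EuclideanSpace ℝ (Fin n) → ℝ} (hΩo : IsOpen Ω) (hΩb : Bornology.IsBounded Ω)
    (hv : LipschitzWith K v) (hv0 : ∀ x ∉ Ω, v x = 0) (hu : ContDiff ℝ 2 u) :
    ∑ i : Fin n, ∫ x, fderiv ℝ v x (EuclideanSpace.single i 1)
        * fderiv ℝ (Ω.indicator u) x (EuclideanSpace.single i 1)
      = ∫ x in Ω, -lap u x * v x := by
  have hpart : ∀ i : Fin n, ∫ x, fderiv ℝ v x (EuclideanSpace.single i 1)
        * fderiv ℝ (Ω.indicator u) x (EuclideanSpace.single i 1)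
      = -∫ x in Ω, v x * fderiv ℝ (fun y => fderiv ℝ u y (EuclideanSpace.single i 1)) x
          (EuclideanSpace.single i 1) := by
    intro i
    rw [← hv.setIntegral_fderiv_mul hΩo hΩb hv0 (hu.fderiv_apply_single i),
      ← setIntegral_eq_integral_of_ae_compl_eq_zero (μ := volume) (s := Ω)]
    · refine setIntegral_congr_fun hΩo.measurableSet fun x hx => ?_
      simp only [hΩo.fderiv_indicator u hx]
    · filter_upwards [hv.ae_fderiv_eq_zero_of_notMem (μ := volume) hv0] with x hx hxΩ
      simp [hx hxΩ]
  rw [Finset.sum_congr rfl fun i _ => hpart i, Finset.sum_neg_distrib, ← integral_finsetSum,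
    ← integral_neg]
  · refine integral_congr_ae (Eventually.of_forall fun x => ?_)
    simp only [lap, ← Finset.mul_sum]
    ring
  · intro i _
    exact hΩb.integrableOn_of_continuous (hv.continuous.mul
      (((hu.fderiv_apply_single i).continuous_fderiv one_ne_zero).clm_apply continuous_const))

theorem setIntegral_lap_mul_self (hΩo : IsOpen Ω) (hΩb : Bornology.IsBounded Ω)
    (hu : ContDiff ℝ 2 u) (hbd : ∀ x ∈ frontier Ω, u x = 0) :
    ∑ i : Fin n, ∫ x, fderiv ℝ (Ω.indicator u) x (EuclideanSpace.single i 1)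
        * fderiv ℝ (Ω.indicator u) x (EuclideanSpace.single i 1)
      = ∫ x in Ω, -lap u x * u x := by
  obtain ⟨K, hK⟩ := hΩb.exists_lipschitzWith_indicator (hu.of_le one_le_two) hbd
  rw [hK.sum_integral_fderiv_mul_eq_lap hΩo hΩb (fun x hx => Set.indicator_of_notMem hx u) hu]
  refine setIntegral_congr_fun hΩo.measurableSet fun x hx => ?_
  simp only [Set.indicator_of_mem hx]

/-- Nonnegativity of the Dirichlet energy of the difference between `u` and its dilation. -/
theorem dirichlet_energy_sub_dilation_nonneg (hΩo : IsOpen Ω) (hΩb : Bornology.IsBounded Ω)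
    (hstar : ∀ x ∈ Ω, ∀ t ∈ Set.Icc (0 : ℝ) 1, t • x ∈ Ω)
    (hu : ContDiff ℝ 2 u) (hbd : ∀ x ∈ frontier Ω, u x = 0) {l : ℝ} (hl : 1 ≤ l) :
    0 ≤ (1 + l ^ 2 * (l ^ n)⁻¹) * (∫ x in Ω, -lap u x * u x)
      - 2 * ∫ x in Ω, -lap u x * Ω.indicator u (l • x) := by
  obtain ⟨K, hK⟩ := hΩb.exists_lipschitzWith_indicator (hu.of_le one_le_two) hbd
  have hl0 : 0 ≤ l := by linarith
  set v := Ω.indicator u with hv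
  set w : EuclideanSpace ℝ (Fin n) → ℝ := fun x => v (l • x) with hw
  have hv0 : ∀ x ∉ Ω, v x = 0 := fun x hx => Set.indicator_of_notMem hx u
  have hw0 : ∀ x ∉ Ω, w x = 0 := fun x hx =>
    Set.indicator_smul_eq_zero_of_starShaped hstar u hl hx
  have hwL : LipschitzWith (K * ‖l‖₊) w := hK.comp (lipschitzWith_smul l)
  rw [← setIntegral_lap_mul_self hΩo hΩb hu hbd, ← hwL.sum_integral_fderiv_mul_eq_lap hΩo hΩb hw0 hu,
    Finset.mul_sum, Finset.mul_sum, ← Finset.sum_sub_distrib]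
  refine Finset.sum_nonneg fun i _ => ?_
  set e : EuclideanSpace ℝ (Fin n) := EuclideanSpace.single i 1
  have hww : ∫ x, fderiv ℝ w x e * fderiv ℝ w x e
      = l ^ 2 * (l ^ n)⁻¹ * ∫ x, fderiv ℝ v x e * fderiv ℝ v x e := by
    have h1 : ∀ x, fderiv ℝ w x e * fderiv ℝ w x e
        = l ^ 2 * (fun y => fderiv ℝ v y e * fderiv ℝ v y e) (l • x) := by
      intro x
      rw [hw, fderiv_comp_smul]
      simp only [smul_apply, smul_eq_mul]
      ring
    rw [integral_congr_ae (Eventually.of_forall h1)]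
    rw [integral_const_mul, Measure.integral_comp_smul_of_nonneg volume
        (fun y => fderiv ℝ v y e * fderiv ℝ v y e) l (hR := hl0), finrank_euclideanSpace_fin,
      smul_eq_mul, mul_assoc]
  have hsq : 0 ≤ ∫ x, (fderiv ℝ v x e * fderiv ℝ v x e + fderiv ℝ w x e * fderiv ℝ w x e
      - 2 * (fderiv ℝ w x e * fderiv ℝ v x e)) :=
    integral_nonneg fun x => by
      show 0 ≤ _
      nlinarith [sq_nonneg (fderiv ℝ v x e - fderiv ℝ w x e)]
  have ivv := hK.integrable_fderiv_mul_fderiv (μ := volume) hΩb hv0 hK e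
  have iww := hwL.integrable_fderiv_mul_fderiv (μ := volume) hΩb hw0 hwL e
  have iwv := hwL.integrable_fderiv_mul_fderiv (μ := volume) hΩb hw0 hK e
  rw [integral_sub (ivv.fun_add iww) (iwv.const_mul 2), integral_add ivv iww, integral_const_mul,
    hww] at hsq
  linarith

/-- The Pohozaev inequality: the boundary term of the Pohozaev identity has a sign on a
star-shaped open set. -/
theorem pohozaev_inequality (hΩo : IsOpen Ω) (hΩb : Bornology.IsBounded Ω)
    (hstar : ∀ x ∈ Ω, ∀ t ∈ Set.Icc (0 : ℝ) 1, t • x ∈ Ω)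
    (hu : ContDiff ℝ 2 u) (hbd : ∀ x ∈ frontier Ω, u x = 0) :
    0 ≤ (2 - (n : ℝ)) * (∫ x in Ω, -lap u x * u x) - 2 * ∫ x in Ω, -lap u x * fderiv ℝ u x x := by
  have hu1 : ContDiff ℝ 1 u := hu.of_le one_le_two
  obtain ⟨K, hK⟩ := hΩb.exists_lipschitzWith_indicator hu1 hbd
  have h1 := hK.hasDerivAt_setIntegral_comp_smul (μ := volume) (f := fun x => -lap u x) hΩo hΩb
    hu.continuous_lap.neg hu1
  have h2 : HasDerivAt (fun l : ℝ => 1 + l ^ 2 * (l ^ n)⁻¹) (2 - (n : ℝ)) 1 := by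
    refine (((hasDerivAt_pow 2 (1 : ℝ)).fun_mul (hasDerivAt_inv_pow_one n)).const_add 1).congr_deriv
      ?_
    norm_num
    ring
  refine ((h2.mul_const (∫ x in Ω, -lap u x * u x)).fun_sub
    (h1.const_mul 2)).hasDerivWithinAt.nonneg_of_forall_nonneg ?_
    fun l hl => dirichlet_energy_sub_dilation_nonneg hΩo hΩb hstar hu hbd hl
  have : ∫ x in Ω, -lap u x * Ω.indicator u ((1 : ℝ) • x) = ∫ x in Ω, -lap u x * u x :=
    setIntegral_congr_fun hΩo.measurableSet fun x hx => by simp [hx]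
  rw [this]
  norm_num

end Pohozaev

/-- the Pohožaev obstruction. -/
theorem pohozaev_obstruction {n : ℕ} (hn : 3 ≤ n)
    (Ω : Set (EuclideanSpace ℝ (Fin n)))
    (hΩo : IsOpen Ω) (hΩb : Bornology.IsBounded Ω)
    (hstar : ∀ x ∈ Ω, ∀ t ∈ Set.Icc (0:ℝ) 1, t • x ∈ Ω)
    (h : EuclideanSpace ℝ (Fin n) → ℝ) (hh : ContDiff ℝ 1 h)
    (hcond : ∀ x ∈ Ω, 0 ≤ h x + (1/2) * ⟪x, gradient h x⟫_ℝ)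
    (hstrict : ∃ x ∈ Ω, 0 < h x + (1/2) * ⟪x, gradient h x⟫_ℝ)
    (u : EuclideanSpace ℝ (Fin n) → ℝ) (hu : ContDiff ℝ 2 u)
    (heq : ∀ x ∈ Ω, -lap u x + h x * u x = |u x| ^ ((4:ℝ)/((n:ℝ)-2)) * u x)
    (hbd : ∀ x ∈ frontier Ω, u x = 0)
    (hint : (¬ ∀ x ∈ Ω, u x = 0) →
      0 < ∫ x in Ω, (h x + ⟪x, gradient h x⟫_ℝ / 2) * (u x)^2) :
    ∀ x ∈ Ω, u x = 0 := by
  by_contra hne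
  have hpos := hint hne
  have hn2 : (0 : ℝ) < (n : ℝ) - 2 := by
    have : (3 : ℝ) ≤ n := by exact_mod_cast hn
    linarith
  have hu1 : ContDiff ℝ 1 u := hu.of_le one_le_two
  have hud : ∀ x, HasFDerivAt u (fderiv ℝ u x) x := fun x =>
    (hu1.differentiable one_ne_zero x).hasFDerivAt
  have hhd : ∀ x, HasFDerivAt h (fderiv ℝ h x) x := fun x =>
    (hh.differentiable one_ne_zero x).hasFDerivAt
  set p : ℝ := 4 / ((n : ℝ) - 2) + 2 with hp
  have hp1 : 1 < p := by
    have : 0 < 4 / ((n : ℝ) - 2) := by positivity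
    linarith
  have hp2 : (4 : ℝ) / ((n : ℝ) - 2) = p - 2 := by linarith
  have hnp : p * (((n : ℝ) - 2) / 2) = n := by
    rw [hp]
    field_simp
    ring
  rw [hp2] at heq
  have hgrad : ∀ x, ⟪x, gradient h x⟫_ℝ = fderiv ℝ h x x := fun x => by
    rw [real_inner_comm, gradient, InnerProductSpace.toDual_symm_apply]
  have hpow : ContDiff ℝ 1 (fun x => |u x| ^ p) := by
    simpa only [Real.norm_eq_abs] using hu1.norm_rpow hp1
  have hsq : ContDiff ℝ 1 (fun x => h x * u x ^ 2) := hh.mul (hu1.pow 2)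
  have hdpow : ∀ x, fderiv ℝ (fun x => |u x| ^ p) x x
      = p * |u x| ^ (p - 2) * u x * fderiv ℝ u x x := fun x => by
    have hd : HasFDerivAt (fun x => |u x| ^ p) _ x :=
      (hasDerivAt_abs_rpow (u x) hp1).comp_hasFDerivAt x (hud x)
    rw [hd.fderiv]
    simp
  have hdsq : ∀ x, fderiv ℝ (fun x => h x * u x ^ 2) x x
      = 2 * h x * u x * fderiv ℝ u x x + fderiv ℝ h x x * u x ^ 2 := fun x => by
    have hd : HasFDerivAt (fun x => h x * u x ^ 2) _ x := (hhd x).mul ((hud x).pow 2)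
    rw [hd.fderiv]
    simp
    ring
  have hint1 : IntegrableOn (fun x => |u x| ^ p) Ω :=
    hΩb.integrableOn_of_continuous hpow.continuous
  have hint2 : IntegrableOn (fun x => h x * u x ^ 2) Ω :=
    hΩb.integrableOn_of_continuous hsq.continuous
  have hint3 : IntegrableOn (fun x => fderiv ℝ h x x * u x ^ 2) Ω :=
    hΩb.integrableOn_of_continuous
      (((hh.continuous_fderiv one_ne_zero).clm_apply continuous_id).mul (hu1.continuous.pow 2))
  have hint4 : IntegrableOn (fun x => fderiv ℝ (fun x => |u x| ^ p) x x) Ω :=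
    hΩb.integrableOn_of_continuous ((hpow.continuous_fderiv one_ne_zero).clm_apply continuous_id)
  have hint5 : IntegrableOn (fun x => fderiv ℝ (fun x => h x * u x ^ 2) x x) Ω :=
    hΩb.integrableOn_of_continuous ((hsq.continuous_fderiv one_ne_zero).clm_apply continuous_id)
  have hdiv1 := setIntegral_fderiv_self_of_starShaped (μ := volume) hΩo hΩb hstar hpow
    fun x hx => by simp [hbd x hx, Real.zero_rpow (by linarith : p ≠ 0)]
  have hdiv2 := setIntegral_fderiv_self_of_starShaped (μ := volume) hΩo hΩb hstar hsq
    fun x hx => by simp [hbd x hx]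
  rw [finrank_euclideanSpace_fin] at hdiv1 hdiv2
  have hener : ∫ x in Ω, -lap u x * u x
      = (∫ x in Ω, |u x| ^ p) - ∫ x in Ω, h x * u x ^ 2 := by
    rw [← integral_sub hint1 hint2]
    refine setIntegral_congr_fun hΩo.measurableSet fun x hx => ?_
    have habs : |u x| ^ (p - 2) * u x ^ 2 = |u x| ^ p := by
      rw [← sq_abs, ← Real.rpow_natCast, ← Real.rpow_add' (abs_nonneg _)]
      · norm_num
      · norm_num
        linarith
    have := heq x hx
    rw [← habs, eq_sub_of_add_eq this]
    ring
  have hmom : ∫ x in Ω, -lap u x * fderiv ℝ u x x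
      = 1 / p * (∫ x in Ω, fderiv ℝ (fun x => |u x| ^ p) x x)
        - 1 / 2 * ((∫ x in Ω, fderiv ℝ (fun x => h x * u x ^ 2) x x)
          - ∫ x in Ω, fderiv ℝ h x x * u x ^ 2) := by
    rw [← integral_sub hint5 hint3, ← integral_const_mul, ← integral_const_mul,
      ← integral_sub (hint4.const_mul _) ((hint5.fun_sub hint3).const_mul _)]
    refine setIntegral_congr_fun hΩo.measurableSet fun x hx => ?_
    rw [hdpow, hdsq, eq_sub_of_add_eq (heq x hx)]
    field_simp
    ring
  have hposeq : ∫ x in Ω, (h x + ⟪x, gradient h x⟫_ℝ / 2) * (u x)^2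
      = (∫ x in Ω, h x * u x ^ 2) + 1 / 2 * ∫ x in Ω, fderiv ℝ h x x * u x ^ 2 := by
    rw [← integral_const_mul, ← integral_add hint2 (hint3.const_mul _)]
    refine setIntegral_congr_fun hΩo.measurableSet fun x _ => ?_
    simp only [hgrad]
    ring
  have hineq := pohozaev_inequality hΩo hΩb hstar hu hbd
  have hpn : 1 / p * (n : ℝ) = ((n : ℝ) - 2) / 2 := by
    rw [one_div_mul_eq_div, div_eq_iff (by linarith)]
    linarith
  rw [hener, hmom, hdiv1, hdiv2, ← mul_assoc, mul_neg, hpn] at hineq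
  rw [hposeq] at hpos
  linarith
end

section
/- Let d > 0 and let b̂ : ℝ³ → ℝ be harmonic on ℝ³ with b̂ ≥ 0 on the half-space {x : x₁ < d} and b̂ ≤ 0 on {x : x₁ > d}. Then ∂₁ b̂(0) ≤ 0. -/
open MeasureTheory Metric Real Filter
open scoped InnerProductSpace Topology ENNReal

abbrev E3 := EuclideanSpace ℝ (Fin 3)

theorem hasDerivAt_max_zero_pow (n : ℕ) (s : ℝ) :
    HasDerivAt (fun s : ℝ => max 0 s ^ (n + 2)) ((n + 2) * max 0 s ^ (n + 1)) s := by
  rcases lt_trichotomy s 0 with hs | rfl | hs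
  · rw [max_eq_left hs.le]
    simp only [ne_eq, Nat.succ_ne_zero, not_false_eq_true, zero_pow, mul_zero]
    refine (hasDerivAt_const s (0 : ℝ)).congr_of_eventuallyEq ?_
    filter_upwards [Iio_mem_nhds hs] with x hx
    simp [max_eq_left (Set.mem_Iio.1 hx).le]
  · have h : (fun s : ℝ => max 0 s ^ (n + 2)) =O[𝓝 0] fun x => ‖x - 0‖ ^ (n + 2) := by
      refine Asymptotics.IsBigO.of_bound 1 (Eventually.of_forall fun x => ?_)
      rw [one_mul, norm_pow, norm_pow, norm_norm, sub_zero]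
      refine pow_le_pow_left₀ (norm_nonneg _) ?_ _
      rw [Real.norm_of_nonneg (le_max_left _ _)]
      exact max_le (norm_nonneg _) (le_abs_self x)
    have := (h.hasFDerivAt (𝕜 := ℝ) (by lia)).hasDerivAt
    simpa using this
  · rw [max_eq_right hs.le]
    have h := hasDerivAt_pow (n + 2) s
    push_cast at h
    refine h.congr_of_eventuallyEq ?_
    filter_upwards [Ioi_mem_nhds hs] with x hx
    simp [max_eq_right (Set.mem_Ioi.1 hx).le]

section

variable {m : ℕ}

/-- The radial weight `(1 - ‖z‖²)₊ ^ k`, supported in the closed unit ball. -/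
noncomputable def ballWeight (k : ℕ) (z : EuclideanSpace ℝ (Fin m)) : ℝ :=
  max 0 (1 - ‖z‖ ^ 2) ^ k

theorem continuous_ballWeight (k : ℕ) :
    Continuous (ballWeight k : EuclideanSpace ℝ (Fin m) → ℝ) := by
  unfold ballWeight; fun_prop

theorem ballWeight_nonneg (k : ℕ) (z : EuclideanSpace ℝ (Fin m)) : 0 ≤ ballWeight k z :=
  pow_nonneg (le_max_left _ _) _

theorem ballWeight_eq_zero (k : ℕ) {z : EuclideanSpace ℝ (Fin m)}
    (hz : z ∉ Metric.closedBall (0 : EuclideanSpace ℝ (Fin m)) 1) :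
    ballWeight (k + 1) z = 0 := by
  have h1 : 1 < ‖z‖ := by simpa using hz
  have h : 1 - ‖z‖ ^ 2 ≤ 0 := by nlinarith
  simp [ballWeight, max_eq_left h]

theorem hasCompactSupport_ballWeight (k : ℕ) :
    HasCompactSupport (ballWeight (k + 1) : EuclideanSpace ℝ (Fin m) → ℝ) :=
  HasCompactSupport.intro (isCompact_closedBall 0 1) fun _ hz => ballWeight_eq_zero k hz

theorem integral_ballWeight_pos (k : ℕ) :
    0 < ∫ z : EuclideanSpace ℝ (Fin m), ballWeight (k + 1) z :=
  (continuous_ballWeight _).integral_pos_of_hasCompactSupport_nonneg_nonzero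
    (hasCompactSupport_ballWeight k) (ballWeight_nonneg _) (x := 0) (by simp [ballWeight])

theorem hasFDerivAt_ballWeight (k : ℕ) (z : EuclideanSpace ℝ (Fin m)) :
    HasFDerivAt (ballWeight (k + 2))
      ((-(2 * (k + 2)) * ballWeight (k + 1) z) • innerSL ℝ z) z := by
  have h1 : HasFDerivAt (fun z : EuclideanSpace ℝ (Fin m) => 1 - ‖z‖ ^ 2)
      (-(2 • innerSL ℝ z)) z :=
    (hasStrictFDerivAt_norm_sq z).hasFDerivAt.const_sub 1
  refine ((hasDerivAt_max_zero_pow k (1 - ‖z‖ ^ 2)).comp_hasFDerivAt z h1).congr_fderiv ?_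
  ext v
  simp [ballWeight]
  ring

theorem fderiv_ballWeight_single (k : ℕ) (z : EuclideanSpace ℝ (Fin m)) (i : Fin m) :
    fderiv ℝ (ballWeight (k + 2)) z (EuclideanSpace.single i 1) =
      -(2 * (k + 2)) * (ballWeight (k + 1) z * z i) := by
  rw [(hasFDerivAt_ballWeight k z).fderiv]
  simp [EuclideanSpace.inner_single_right]
  ring

theorem integrable_ballWeight_mul (k : ℕ) {g : EuclideanSpace ℝ (Fin m) → ℝ}
    (hg : Continuous g) : Integrable fun z => ballWeight (k + 1) z * g z :=
  ((continuous_ballWeight _).mul hg).integrable_of_hasCompactSupport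
    (hasCompactSupport_ballWeight k).mul_right

theorem integral_ballWeight_mul_fderiv (k : ℕ) {g : EuclideanSpace ℝ (Fin m) → ℝ}
    (hg : ContDiff ℝ 1 g) (i : Fin m) :
    ∫ z, ballWeight (k + 2) z * fderiv ℝ g z (EuclideanSpace.single i 1) =
      2 * (k + 2) * ∫ z, ballWeight (k + 1) z * (z i * g z) := by
  have hg' : Continuous fun z => fderiv ℝ g z (EuclideanSpace.single i 1) :=
    (hg.continuous_fderiv one_ne_zero).clm_apply continuous_const
  have hz : Continuous fun z : EuclideanSpace ℝ (Fin m) => z i * g z :=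
    (by fun_prop : Continuous fun z : EuclideanSpace ℝ (Fin m) => z i).mul hg.continuous
  have e (z : EuclideanSpace ℝ (Fin m)) :
      fderiv ℝ (ballWeight (k + 2)) z (EuclideanSpace.single i 1) * g z =
        -(2 * (k + 2)) * (ballWeight (k + 1) z * (z i * g z)) := by
    rw [fderiv_ballWeight_single]; ring
  rw [integral_mul_fderiv_eq_neg_fderiv_mul_of_integrable]
  · simp_rw [e, integral_const_mul]
    ring
  · simp_rw [e]
    exact (integrable_ballWeight_mul k hz).const_mul _
  · exact integrable_ballWeight_mul (k + 1) hg'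
  · exact integrable_ballWeight_mul (k + 1) hg.continuous
  · exact fun x _ => (hasFDerivAt_ballWeight k x).differentiableAt
  · exact fun x _ => hg.differentiable one_ne_zero x

theorem hasDerivAt_integral_ballWeight_mul (k : ℕ)
    {g g' : ℝ → EuclideanSpace ℝ (Fin m) → ℝ}
    (hg : Continuous (Function.uncurry g)) (hg' : Continuous (Function.uncurry g'))
    (h : ∀ t z, HasDerivAt (fun s => g s z) (g' t z) t) (t : ℝ) :
    HasDerivAt (fun s => ∫ z, ballWeight (k + 1) z * g s z)
      (∫ z, ballWeight (k + 1) z * g' t z) t := by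
  obtain ⟨C, hC⟩ := ((isCompact_closedBall t 1).prod
    (isCompact_closedBall (0 : EuclideanSpace ℝ (Fin m)) 1)).exists_bound_of_continuousOn
      hg'.continuousOn
  have hgs (s : ℝ) : Continuous (g s) := hg.comp (Continuous.prodMk_right s)
  have hgs' (s : ℝ) : Continuous (g' s) := hg'.comp (Continuous.prodMk_right s)
  refine (hasDerivAt_integral_of_dominated_loc_of_deriv_le
    (bound := fun z => ballWeight (k + 1) z * C) (Metric.closedBall_mem_nhds t one_pos)
    (Eventually.of_forall fun s => (integrable_ballWeight_mul k (hgs s)).aestronglyMeasurable)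
    (integrable_ballWeight_mul k (hgs t))
    (integrable_ballWeight_mul k (hgs' t)).aestronglyMeasurable
    (Eventually.of_forall fun z s hs => ?_)
    (integrable_ballWeight_mul k continuous_const)
    (Eventually.of_forall fun z s _ => (h s z).const_mul _)).2
  rw [norm_mul, Real.norm_of_nonneg (ballWeight_nonneg _ _)]
  by_cases hz : z ∈ Metric.closedBall (0 : EuclideanSpace ℝ (Fin m)) 1
  · exact mul_le_mul_of_nonneg_left (hC (s, z) ⟨hs, hz⟩) (ballWeight_nonneg _ _)
  · simp [ballWeight_eq_zero k hz]

theorem fderiv_comp_add_smul {g : EuclideanSpace ℝ (Fin m) → ℝ} (hg : Differentiable ℝ g)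
    (a z v : EuclideanSpace ℝ (Fin m)) (t : ℝ) :
    fderiv ℝ (fun z => g (a + t • z)) z v = t * fderiv ℝ g (a + t • z) v := by
  have h1 : HasFDerivAt (fun z : EuclideanSpace ℝ (Fin m) => a + t • z)
      (t • ContinuousLinearMap.id ℝ _) z := ((hasFDerivAt_id z).const_smul t).const_add a
  have h2 : HasFDerivAt (fun z => g (a + t • z)) _ z :=
    (hg (a + t • z)).hasFDerivAt.comp z h1
  rw [h2.fderiv]
  simp

theorem integral_ballWeight_mul_radial_fderiv (k : ℕ) {u : EuclideanSpace ℝ (Fin m) → ℝ}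
    (hu : ContDiff ℝ 2 u) (hlap : ∀ x, lap u x = 0) (a : EuclideanSpace ℝ (Fin m)) (t : ℝ) :
    ∫ z, ballWeight (k + 1) z * fderiv ℝ u (a + t • z) z = 0 := by
  let p (i : Fin m) (x : EuclideanSpace ℝ (Fin m)) : ℝ :=
    fderiv ℝ u x (EuclideanSpace.single i 1)
  have hp (i : Fin m) : ContDiff ℝ 1 (p i) :=
    (hu.fderiv_right (m := 1) (by norm_num)).clm_apply contDiff_const
  have hpt (i : Fin m) : ContDiff ℝ 1 fun z => p i (a + t • z) :=
    (hp i).comp (by fun_prop)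
  have hexp (z : EuclideanSpace ℝ (Fin m)) :
      ballWeight (k + 1) z * fderiv ℝ u (a + t • z) z =
        ∑ i, ballWeight (k + 1) z * (z i * p i (a + t • z)) := by
    rw [← Finset.mul_sum]
    congr 1
    simp only [p]
    generalize fderiv ℝ u (a + t • z) = L
    conv_lhs => rw [← (EuclideanSpace.basisFun (Fin m) ℝ).sum_repr z]
    simp
  have hint (i : Fin m) :
      Integrable fun z => ballWeight (k + 1) z * (z i * p i (a + t • z)) :=
    integrable_ballWeight_mul k
      ((by fun_prop : Continuous fun z : EuclideanSpace ℝ (Fin m) => z i).mul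
        (hpt i).continuous)
  have hint' (i : Fin m) : Integrable fun z => ballWeight (k + 2) z *
      fderiv ℝ (fun z => p i (a + t • z)) z (EuclideanSpace.single i 1) :=
    integrable_ballWeight_mul (k + 1)
      (((hpt i).continuous_fderiv one_ne_zero).clm_apply continuous_const)
  have hzero : ∑ i, ∫ z, ballWeight (k + 2) z *
      fderiv ℝ (fun z => p i (a + t • z)) z (EuclideanSpace.single i 1) = 0 := by
    rw [← integral_finsetSum _ fun i _ => hint' i]
    refine integral_eq_zero_of_ae (Eventually.of_forall fun z => ?_)
    simp only [Pi.zero_apply]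
    simp_rw [fderiv_comp_add_smul ((hp _).differentiable one_ne_zero)]
    rw [← Finset.mul_sum, ← Finset.mul_sum]
    have := hlap (a + t • z)
    unfold lap at this
    simp [p, this]
  simp_rw [fun i => integral_ballWeight_mul_fderiv k (hpt i) i] at hzero
  rw [← Finset.mul_sum] at hzero
  simp_rw [hexp]
  rw [integral_finsetSum _ fun i _ => hint i]
  exact (mul_eq_zero.1 hzero).resolve_left (by positivity)

/-- Weighted mean value property of harmonic functions. -/
theorem integral_ballWeight_mul_harmonic (k : ℕ) {u : EuclideanSpace ℝ (Fin m) → ℝ}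
    (hu : ContDiff ℝ 2 u) (hlap : ∀ x, lap u x = 0) (a : EuclideanSpace ℝ (Fin m)) (t : ℝ) :
    ∫ z, ballWeight (k + 1) z * u (a + t • z) =
      (∫ z : EuclideanSpace ℝ (Fin m), ballWeight (k + 1) z) * u a := by
  have hd : ∀ s, HasDerivAt (fun s : ℝ => ∫ z, ballWeight (k + 1) z * u (a + s • z)) 0 s := by
    intro s
    rw [← integral_ballWeight_mul_radial_fderiv k hu hlap a s]
    refine hasDerivAt_integral_ballWeight_mul k (g := fun s z => u (a + s • z))
      (g' := fun s z => fderiv ℝ u (a + s • z) z) ?_ ?_ (fun s z => ?_) s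
    · exact hu.continuous.comp (by fun_prop)
    · exact ((hu.continuous_fderiv two_ne_zero).comp (by fun_prop)).clm_apply continuous_snd
    · have h1 : HasDerivAt (fun s : ℝ => a + s • z) z s := by
        simpa using ((hasDerivAt_id s).smul_const z).const_add a
      exact (hu.differentiable two_ne_zero _).hasFDerivAt.comp_hasDerivAt s h1
  have := is_const_of_deriv_eq_zero (fun s => (hd s).differentiableAt) (fun s => (hd s).deriv) t 0
  simpa [integral_mul_const] using this

/-- Weighted mean value property for directional derivatives of harmonic functions. -/
theorem integral_ballWeight_mul_fderiv_harmonic (k : ℕ) {u : EuclideanSpace ℝ (Fin m) → ℝ}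
    (hu : ContDiff ℝ 2 u) (hlap : ∀ x, lap u x = 0) (a v : EuclideanSpace ℝ (Fin m)) (t : ℝ) :
    ∫ z, ballWeight (k + 1) z * fderiv ℝ u (a + t • z) v =
      (∫ z : EuclideanSpace ℝ (Fin m), ballWeight (k + 1) z) * fderiv ℝ u a v := by
  have hpath (c : EuclideanSpace ℝ (Fin m)) (s : ℝ) :
      HasDerivAt (fun s : ℝ => u (a + s • v + c)) (fderiv ℝ u (a + s • v + c) v) s := by
    have h1 : HasDerivAt (fun s : ℝ => a + s • v + c) v s := by
      simpa using (((hasDerivAt_id s).smul_const v).const_add a).add_const c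
    exact (hu.differentiable two_ne_zero _).hasFDerivAt.comp_hasDerivAt s h1
  have h1 := hasDerivAt_integral_ballWeight_mul k (g := fun s z => u (a + s • v + t • z))
    (g' := fun s z => fderiv ℝ u (a + s • v + t • z) v)
    (hu.continuous.comp (by fun_prop))
    (((hu.continuous_fderiv two_ne_zero).comp (by fun_prop)).clm_apply continuous_const)
    (fun s z => hpath (t • z) s) 0
  simp_rw [integral_ballWeight_mul_harmonic k hu hlap] at h1
  have h2 := (hpath 0 0).const_mul (∫ z : EuclideanSpace ℝ (Fin m), ballWeight (k + 1) z)
  simp only [add_zero, zero_smul] at h1 h2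
  exact h1.unique h2

end

/-- sign of the derivative of an entire harmonic function with signs
on two half-spaces. -/
theorem harmonic_halfspace_sign_derivative
    (d : ℝ) (hd : 0 < d) (b : E3 → ℝ) (hb : ContDiff ℝ 2 b)
    (hharm : ∀ x, lap b x = 0)
    (hpos : ∀ x : E3, x 0 < d → 0 ≤ b x) (hneg : ∀ x : E3, d < x 0 → b x ≤ 0) :
    fderiv ℝ b 0 (EuclideanSpace.single 0 1) ≤ 0 := by
  set A : ℝ := ∫ z : E3, ballWeight 1 z
  set B : ℝ := ∫ z : E3, ballWeight 2 z
  have hBpos : 0 < B := integral_ballWeight_pos 1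
  have key (t : ℝ) : t ^ 2 * (B * fderiv ℝ b 0 (EuclideanSpace.single 0 1)) ≤
      4 * (d * (A * b 0)) := by
    have hbt : ContDiff ℝ 1 fun z : E3 => b (0 + t • z) :=
      (hb.of_le one_le_two).comp (by fun_prop)
    have h1 := integral_ballWeight_mul_fderiv 0 hbt 0
    simp_rw [fderiv_comp_add_smul (hb.differentiable two_ne_zero), mul_left_comm _ t] at h1
    rw [integral_const_mul, integral_ballWeight_mul_fderiv_harmonic 1 hb hharm] at h1
    have h2 := integral_ballWeight_mul_harmonic 0 hb hharm 0 t
    have h3 : ∫ z : E3, t * (ballWeight 1 z * (z 0 * b (0 + t • z))) ≤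
        ∫ z : E3, d * (ballWeight 1 z * b (0 + t • z)) := by
      refine integral_mono ((integrable_ballWeight_mul 0 ?_).const_mul t)
        ((integrable_ballWeight_mul 0 hbt.continuous).const_mul d) fun z => ?_
      · exact (by fun_prop : Continuous fun z : E3 => z 0).mul hbt.continuous
      · have h4 : (t * z 0 - d) * b (0 + t • z) ≤ 0 := by
          have h0 : (0 + t • z) 0 = t * z 0 := by simp
          rcases lt_trichotomy (t * z 0) d with h | h | h
          · exact mul_nonpos_of_nonpos_of_nonneg (by linarith) (hpos _ (by rwa [h0]))
          · simp [h]
          · exact mul_nonpos_of_nonneg_of_nonpos (by linarith) (hneg _ (by rwa [h0]))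
        have h5 := mul_nonpos_of_nonneg_of_nonpos (ballWeight_nonneg 1 z) h4
        dsimp only
        linarith
    rw [integral_const_mul, integral_const_mul] at h3
    simp only [zero_add, Nat.cast_zero, Nat.reduceAdd] at h1 h2 h3
    rw [h2] at h3
    linear_combination t * h1 + 4 * h3
  by_contra! hD
  have hpos' := mul_pos hBpos hD
  set M := B * fderiv ℝ b 0 (EuclideanSpace.single 0 1)
  have h := key (1 + |4 * (d * (A * b 0))| / M)
  have hq : 0 ≤ |4 * (d * (A * b 0))| / M := by positivity
  have hqM : |4 * (d * (A * b 0))| / M * M = |4 * (d * (A * b 0))| := by field_simp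
  have := le_abs_self (4 * (d * (A * b 0)))
  nlinarith [mul_nonneg hq hpos'.le, mul_nonneg (mul_nonneg hq hq) hpos'.le]
end
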